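/- Let R = (C, Δ) be a finite generalized root system for a connected basic datum (X, ρ). Then for every x ∈ X there is a unique element ω_0^x of the Weyl groupoid W(R) ending at x whose length is maximal among the lengths of elements of W(R) ending at x. Moreover, ℓ(ω_0^x) = ℓ(ω_0^y) for all x, y ∈ X. -/

import Mathlib

open Function

/-- The reflection `s_i` determined by the `i`-th row of a generalized Cartan matrix `C`,
acting on `ℤ^θ`; on the standard basis it is `s_i(α_j) = α_j - C i j • α_i`. -/
def cartanRefl {θ : ℕ} (C : Matrix (Fin θ) (Fin θ) ℤ) (i : Fin θ) :
    (Fin θ → ℤ) → (Fin θ → ℤ) :=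
  fun v => v - (∑ j, C i j * v j) • Pi.single i 1

/-- A generalized root system `(C, Δ)` over a connected basic datum `(X, ρ)`. -/
structure GRS (θ : ℕ) (X : Type*) where
  nonempty : Nonempty X
  /-- The basic datum: a family of involutive permutations of `X`. -/
  ρ : Fin θ → Equiv.Perm X
  ρ_invol : ∀ i, ρ i * ρ i = 1
  /-- Connectedness of the basic datum. -/
  connected : ∀ x y : X, Relation.ReflTransGen (fun a b => ∃ i, ρ i a = b) x y
  /-- The Cartan datum: a bundle of generalized Cartan matrices. -/
  C : X → Matrix (Fin θ) (Fin θ) ℤ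
  C_diag : ∀ x i, C x i i = 2
  C_offdiag : ∀ x i j, i ≠ j → C x i j ≤ 0
  C_zero_iff : ∀ x i j, i ≠ j → (C x i j = 0 ↔ C x j i = 0)
  C_compat : ∀ x i j, C (ρ i x) i j = C x i j
  /-- The bundle of root sets. -/
  Δ : X → Set (Fin θ → ℤ)
  /-- Axiom (1): `Δ^x = Δ^x_+ ∪ Δ^x_-`, where `Δ^x_± = ±(Δ^x ∩ ℕ₀^θ)`. -/
  root_pos_neg : ∀ x, Δ x = (Δ x ∩ {v | ∀ k, 0 ≤ v k}) ∪ ((fun v => -v) '' (Δ x ∩ {v | ∀ k, 0 ≤ v k}))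
  /-- Axiom (2): `Δ^x ∩ ℤα_i = {α_i, -α_i}`. -/
  root_simple : ∀ x i, Δ x ∩ {v | ∃ n : ℤ, v = n • (Pi.single i 1 : Fin θ → ℤ)}
      = {Pi.single i 1, -Pi.single i 1}
  /-- Axiom (3): `s_i^x(Δ^x) = Δ^{ρ_i(x)}`. -/
  root_refl : ∀ x i, cartanRefl (C x) i '' Δ x = Δ (ρ i x)
  /-- Axiom (4): `(ρ_i ρ_j)^{m^x_{ij}}(x) = x` where `m^x_{ij} = |Δ^x ∩ (ℕ₀α_i + ℕ₀α_j)|`. -/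
  root_coxeter : ∀ x i j, i ≠ j →
    (Δ x ∩ {v | ∃ p q : ℕ, v = p • (Pi.single i 1 : Fin θ → ℤ) + q • Pi.single j 1}).Finite →
    ((ρ i * ρ j) ^
      (Δ x ∩ {v | ∃ p q : ℕ, v = p • (Pi.single i 1 : Fin θ → ℤ) + q • Pi.single j 1}).ncard) x = x

namespace GRS

variable {θ : ℕ} {X : Type*} (R : GRS θ X)

/-- The set of positive roots `Δ^x_+` at `x`. -/
def pos (x : X) : Set (Fin θ → ℤ) := {v ∈ R.Δ x | ∀ k, 0 ≤ v k}

/-- Membership in the Weyl groupoid `W(R)`: `Weyl R x g y` says that the triple `(x, g, y)`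
belongs to the subgroupoid of `X × GL(ℤ^θ) × X` generated by the `ς_i^x = (x, s_i^x, ρ_i(x))`. -/
inductive Weyl : X → ((Fin θ → ℤ) → (Fin θ → ℤ)) → X → Prop
  | nil (x : X) : Weyl x _root_.id x
  | cons (x : X) (i : Fin θ) {g : (Fin θ → ℤ) → (Fin θ → ℤ)} {y : X} :
      Weyl (R.ρ i x) g y → Weyl x (cartanRefl (R.C x) i ∘ g) y

/-- Endpoint of the word `ς_{i_1}^x ς_{i_2} ⋯ ς_{i_t}` (with implicit superscripts). -/
def wordEnd : X → List (Fin θ) → X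
  | x, [] => x
  | x, i :: l => wordEnd (R.ρ i x) l

/-- The element of `GL(ℤ^θ)` given by the word `ς_{i_1}^x ς_{i_2} ⋯ ς_{i_t}`:
the composition `s_{i_1}^x ∘ s_{i_2}^{ρ_{i_1}(x)} ∘ ⋯`. -/
def wordMap : X → List (Fin θ) → ((Fin θ → ℤ) → (Fin θ → ℤ))
  | _, [] => _root_.id
  | x, i :: l => cartanRefl (R.C x) i ∘ wordMap (R.ρ i x) l

/-- The length `ℓ(w)` of the element `w = (x, g, y)` of the Weyl groupoid: the least number of
generators needed to express it. -/
noncomputable def len (x : X) (g : (Fin θ → ℤ) → (Fin θ → ℤ)) (y : X) : ℕ :=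
  sInf {t | ∃ l : List (Fin θ), l.length = t ∧ R.wordEnd x l = y ∧ R.wordMap x l = g}

/-- The set of real roots `(Δ^{re})^x` at `x`. -/
def realRoots (x : X) : Set (Fin θ → ℤ) :=
  {v | ∃ (i : Fin θ) (g : (Fin θ → ℤ) → (Fin θ → ℤ)) (y : X), R.Weyl x g y ∧ v = g (Pi.single i 1)}

/-- The generalized root system is finite: its Weyl groupoid is a finite set. -/
def FiniteWeyl : Prop :=
  {p : X × ((Fin θ → ℤ) → (Fin θ → ℤ)) × X | R.Weyl p.1 p.2.1 p.2.2}.Finite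

end GRS

section CartanRefl

variable {θ : ℕ} (C : Matrix (Fin θ) (Fin θ) ℤ) {i : Fin θ}

theorem cartanRefl_apply_of_ne {k : Fin θ} (h : k ≠ i) (v : Fin θ → ℤ) :
    cartanRefl C i v k = v k := by
  simp [cartanRefl, h]

theorem cartanRefl_isLinearMap : IsLinearMap ℤ (cartanRefl C i) where
  map_add v w := by
    simp only [cartanRefl, Pi.add_apply, mul_add, Finset.sum_add_distrib, add_smul]
    abel
  map_smul c v := by
    simp only [cartanRefl, Pi.smul_apply, smul_eq_mul, smul_sub, smul_smul, Finset.mul_sum]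
    congr 2
    exact Finset.sum_congr rfl fun _ _ => by ring

theorem cartanRefl_single (j : Fin θ) :
    cartanRefl C i (Pi.single j 1) = Pi.single j 1 - C i j • Pi.single i 1 := by
  simp [cartanRefl, Pi.single_apply]

end CartanRefl

namespace GRS

section Roots

variable {θ : ℕ} {X : Type*} (R : GRS θ X)

theorem ρ_ρ (i : Fin θ) (x : X) : R.ρ i (R.ρ i x) = x := by
  rw [← Equiv.Perm.mul_apply, R.ρ_invol, Equiv.Perm.one_apply]

theorem cartanRefl_ρ (x : X) (i : Fin θ) :
    cartanRefl (R.C (R.ρ i x)) i = cartanRefl (R.C x) i := by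
  funext v
  simp [cartanRefl, R.C_compat]

theorem cartanRefl_self (x : X) (i : Fin θ) :
    cartanRefl (R.C x) i (Pi.single i 1) = -Pi.single i 1 := by
  rw [cartanRefl_single, R.C_diag, two_smul]
  abel

theorem cartanRefl_cartanRefl (x : X) (i : Fin θ) (v : Fin θ → ℤ) :
    cartanRefl (R.C x) i (cartanRefl (R.C x) i v) = v := by
  have hl := cartanRefl_isLinearMap (R.C x) (i := i)
  conv_lhs => rw [show cartanRefl (R.C x) i v = v - (∑ j, R.C x i j * v j) • Pi.single i 1 from rfl]
  rw [hl.map_sub, hl.map_smul, R.cartanRefl_self]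
  simp [cartanRefl]

theorem neg_mem {x : X} {v : Fin θ → ℤ} (h : v ∈ R.Δ x) : -v ∈ R.Δ x := by
  rw [R.root_pos_neg] at h ⊢
  rcases h with h | ⟨w, hw, rfl⟩
  · exact Or.inr ⟨v, h, rfl⟩
  · simpa using Or.inl hw

theorem single_mem (x : X) (i : Fin θ) : Pi.single i 1 ∈ R.Δ x := by
  have h : Pi.single i 1 ∈ ({Pi.single i 1, -Pi.single i 1} : Set (Fin θ → ℤ)) := by simp
  rw [← R.root_simple x i] at h
  exact h.1

theorem ne_zero_of_mem (i : Fin θ) {x : X} {v : Fin θ → ℤ} (h : v ∈ R.Δ x) : v ≠ 0 := by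
  rintro rfl
  have h0 : (0 : Fin θ → ℤ) ∈ ({Pi.single i 1, -Pi.single i 1} : Set (Fin θ → ℤ)) := by
    rw [← R.root_simple x i]
    exact ⟨h, 0, by simp⟩
  rcases h0 with h0 | h0
  · simpa using congrFun h0 i
  · simpa using congrFun h0 i

theorem nonneg_or_nonpos {x : X} {v : Fin θ → ℤ} (h : v ∈ R.Δ x) :
    (∀ k, 0 ≤ v k) ∨ ∀ k, v k ≤ 0 := by
  rw [R.root_pos_neg] at h
  rcases h with h | ⟨w, hw, rfl⟩
  · exact Or.inl h.2
  · exact Or.inr fun k => by simpa using hw.2 k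

/-- The positive roots at `x` supported on `J`. -/
def posOn (J : Set (Fin θ)) (x : X) : Set (Fin θ → ℤ) :=
  {v ∈ R.Δ x | (∀ k, 0 ≤ v k) ∧ (∃ k, 0 < v k) ∧ ∀ k ∉ J, v k = 0}

theorem single_mem_posOn {J : Set (Fin θ)} {i : Fin θ} (hi : i ∈ J) (x : X) :
    Pi.single i 1 ∈ R.posOn J x := by
  refine ⟨R.single_mem x i, fun k => ?_, ⟨i, by simp⟩, fun k hk => ?_⟩
  · by_cases h : k = i <;> simp [h]
  · rw [Pi.single_apply, if_neg (ne_of_mem_of_not_mem hi hk).symm]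

theorem refl_mem {x : X} (i : Fin θ) {v : Fin θ → ℤ} (h : v ∈ R.Δ x) :
    cartanRefl (R.C x) i v ∈ R.Δ (R.ρ i x) :=
  R.root_refl x i ▸ ⟨v, h, rfl⟩

theorem exists_pos_of_ne_single {J : Set (Fin θ)} {x : X} {i : Fin θ} {v : Fin θ → ℤ}
    (h : v ∈ R.posOn J x) (hne : v ≠ Pi.single i 1) : ∃ k, k ≠ i ∧ 0 < v k := by
  by_contra! hk
  obtain ⟨hv, h0, ⟨k₀, hk₀⟩, -⟩ := h
  have hvi : v ∈ R.Δ x ∩ {v | ∃ n : ℤ, v = n • (Pi.single i 1 : Fin θ → ℤ)} := by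
    refine ⟨hv, v i, funext fun k => ?_⟩
    by_cases hki : k = i
    · subst hki; simp
    · simpa [hki] using le_antisymm (hk k hki) (h0 k)
  rw [R.root_simple] at hvi
  rcases hvi with rfl | rfl
  · exact hne rfl
  · have := h0 i
    simp at this

theorem refl_mem_posOn {J : Set (Fin θ)} {x : X} {i : Fin θ} (hi : i ∈ J) {v : Fin θ → ℤ}
    (h : v ∈ R.posOn J x) (hne : v ≠ Pi.single i 1) :
    cartanRefl (R.C x) i v ∈ R.posOn J (R.ρ i x) \ {Pi.single i 1} := by
  obtain ⟨k, hki, hk⟩ := R.exists_pos_of_ne_single h hne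
  have hk' : 0 < cartanRefl (R.C x) i v k := by rwa [cartanRefl_apply_of_ne _ hki]
  refine ⟨⟨R.refl_mem i h.1, ?_, ⟨k, hk'⟩, fun l hl => ?_⟩, fun he => ?_⟩
  · refine (R.nonneg_or_nonpos (R.refl_mem i h.1)).resolve_right fun hn => ?_
    exact absurd (hn k) (not_le.2 hk')
  · rw [cartanRefl_apply_of_ne _ (ne_of_mem_of_not_mem hi hl).symm]
    exact h.2.2.2 l hl
  · rw [Set.mem_singleton_iff.1 he] at hk'
    simp [hki] at hk'

theorem cartanRefl_injective (x : X) (i : Fin θ) : Function.Injective (cartanRefl (R.C x) i) :=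
  Function.LeftInverse.injective (R.cartanRefl_cartanRefl x i)

theorem posOn_ρ {J : Set (Fin θ)} {i : Fin θ} (hi : i ∈ J) (x : X) :
    R.posOn J (R.ρ i x) \ {Pi.single i 1} =
      cartanRefl (R.C x) i '' (R.posOn J x \ {Pi.single i 1}) := by
  apply Set.Subset.antisymm
  · rintro v ⟨hv, hne⟩
    refine ⟨cartanRefl (R.C x) i v, ?_, R.cartanRefl_cartanRefl x i v⟩
    simpa [R.cartanRefl_ρ, R.ρ_ρ] using R.refl_mem_posOn hi hv hne
  · rintro _ ⟨v, ⟨hv, hne⟩, rfl⟩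
    exact R.refl_mem_posOn hi hv hne

theorem encard_posOn_ρ {J : Set (Fin θ)} {i : Fin θ} (hi : i ∈ J) (x : X) :
    (R.posOn J (R.ρ i x)).encard = (R.posOn J x).encard := by
  rw [← Set.encard_sdiff_singleton_add_one (R.single_mem_posOn hi (R.ρ i x)), R.posOn_ρ hi,
    (R.cartanRefl_injective x i).encard_image,
    Set.encard_sdiff_singleton_add_one (R.single_mem_posOn hi x)]

end Roots

section Words

variable {θ : ℕ} {X : Type*} (R : GRS θ X)

theorem wordEnd_append (x : X) (l t : List (Fin θ)) :
    R.wordEnd x (l ++ t) = R.wordEnd (R.wordEnd x l) t := by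
  induction l generalizing x with
  | nil => rfl
  | cons i l ih => exact ih _

theorem wordMap_append (x : X) (l t : List (Fin θ)) :
    R.wordMap x (l ++ t) = R.wordMap x l ∘ R.wordMap (R.wordEnd x l) t := by
  induction l generalizing x with
  | nil => rfl
  | cons i l ih =>
    change cartanRefl (R.C x) i ∘ R.wordMap (R.ρ i x) (l ++ t) = _
    rw [ih]
    rfl

theorem wordMap_singleton (x : X) (i : Fin θ) : R.wordMap x [i] = cartanRefl (R.C x) i := rfl

theorem wordEnd_singleton (x : X) (i : Fin θ) : R.wordEnd x [i] = R.ρ i x := rfl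

theorem wordMap_isLinearMap (x : X) (l : List (Fin θ)) : IsLinearMap ℤ (R.wordMap x l) := by
  induction l generalizing x with
  | nil => exact (LinearMap.id : (Fin θ → ℤ) →ₗ[ℤ] _).isLinear
  | cons i l ih =>
    exact ((cartanRefl_isLinearMap (R.C x) (i := i)).mk'.comp (ih (R.ρ i x)).mk').isLinear

theorem wordMap_eq_sum (x : X) (l : List (Fin θ)) (v : Fin θ → ℤ) :
    R.wordMap x l v = ∑ i, v i • R.wordMap x l (Pi.single i 1) := by
  have h := LinearMap.pi_apply_eq_sum_univ ((R.wordMap_isLinearMap x l).mk' _) v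
  simp only [IsLinearMap.mk'_apply] at h
  rw [h]
  congr! 4 with i _ j
  simp [Pi.single_apply, eq_comm]

theorem wordMap_mem (x : X) (l : List (Fin θ)) {v : Fin θ → ℤ} (h : v ∈ R.Δ (R.wordEnd x l)) :
    R.wordMap x l v ∈ R.Δ x := by
  induction l generalizing x with
  | nil => exact h
  | cons i l ih =>
    have := R.refl_mem i (ih (R.ρ i x) h)
    rwa [R.cartanRefl_ρ, R.ρ_ρ] at this

theorem wordMap_apply_of_notMem {J : Set (Fin θ)} (x : X) {l : List (Fin θ)} (hl : ∀ i ∈ l, i ∈ J)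
    (v : Fin θ → ℤ) {k : Fin θ} (hk : k ∉ J) : R.wordMap x l v k = v k := by
  induction l generalizing x with
  | nil => rfl
  | cons i l ih =>
    change cartanRefl (R.C x) i (R.wordMap (R.ρ i x) l v) k = _
    rw [cartanRefl_apply_of_ne _ (ne_of_mem_of_not_mem (hl i (by simp)) hk).symm,
      ih _ fun j hj => hl j (by simp [hj])]

theorem weyl_iff {x y : X} {g : (Fin θ → ℤ) → (Fin θ → ℤ)} :
    R.Weyl x g y ↔ ∃ l, R.wordEnd x l = y ∧ R.wordMap x l = g := by
  constructor
  · intro h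
    induction h with
    | nil x => exact ⟨[], rfl, rfl⟩
    | cons x i _ ih =>
      obtain ⟨l, rfl, rfl⟩ := ih
      exact ⟨i :: l, rfl, rfl⟩
  · rintro ⟨l, rfl, rfl⟩
    induction l generalizing x with
    | nil => exact .nil x
    | cons i l ih => exact .cons x i ih

/-- Two words starting at `x` represent the same element of the Weyl groupoid. -/
def WordEq (x : X) (l l' : List (Fin θ)) : Prop :=
  R.wordEnd x l = R.wordEnd x l' ∧ R.wordMap x l = R.wordMap x l'

variable {R}

theorem WordEq.symm {x : X} {l l' : List (Fin θ)} (h : R.WordEq x l l') : R.WordEq x l' l :=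
  ⟨h.1.symm, h.2.symm⟩

theorem WordEq.trans {x : X} {l l' l'' : List (Fin θ)} (h : R.WordEq x l l')
    (h' : R.WordEq x l' l'') : R.WordEq x l l'' :=
  ⟨h.1.trans h'.1, h.2.trans h'.2⟩

theorem WordEq.append_right {x : X} {l l' : List (Fin θ)} (h : R.WordEq x l l')
    (t : List (Fin θ)) : R.WordEq x (l ++ t) (l' ++ t) := by
  simp only [WordEq, wordEnd_append, wordMap_append, h.1, h.2, and_self]

theorem WordEq.append_left {x : X} {l l' : List (Fin θ)} (t : List (Fin θ))
    (h : R.WordEq (R.wordEnd x t) l l') : R.WordEq x (t ++ l) (t ++ l') := by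
  simp only [WordEq, wordEnd_append, wordMap_append, h.1, h.2, and_self]

variable (R)

theorem wordEq_pair (x : X) (i : Fin θ) : R.WordEq x [i, i] [] := by
  refine ⟨R.ρ_ρ i x, funext fun v => ?_⟩
  change cartanRefl (R.C x) i (cartanRefl (R.C (R.ρ i x)) i v) = v
  rw [R.cartanRefl_ρ, R.cartanRefl_cartanRefl]

theorem wordEq_append_reverse (x : X) (l : List (Fin θ)) : R.WordEq x (l ++ l.reverse) [] := by
  induction l using List.reverseRecOn generalizing x with
  | nil => exact ⟨rfl, rfl⟩
  | append_singleton l i ih =>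
    rw [List.reverse_append, List.append_assoc, List.reverse_singleton, ← List.append_assoc [i],
      List.singleton_append]
    exact ((R.wordEq_pair _ i).append_right l.reverse |>.append_left l).trans (ih x)

theorem wordEnd_reverse (x : X) (l : List (Fin θ)) :
    R.wordEnd (R.wordEnd x l) l.reverse = x := by
  rw [← wordEnd_append]
  exact (R.wordEq_append_reverse x l).1

theorem wordMap_wordMap_reverse (x : X) (l : List (Fin θ)) (v : Fin θ → ℤ) :
    R.wordMap x l (R.wordMap (R.wordEnd x l) l.reverse v) = v := by
  have := (R.wordEq_append_reverse x l).2
  rw [wordMap_append] at this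
  exact congrFun this v

theorem wordMap_reverse_wordMap (x : X) (l : List (Fin θ)) (v : Fin θ → ℤ) :
    R.wordMap (R.wordEnd x l) l.reverse (R.wordMap x l v) = v := by
  have := R.wordMap_wordMap_reverse (R.wordEnd x l) l.reverse v
  rwa [R.wordEnd_reverse, List.reverse_reverse] at this

theorem wordMap_ne_zero (x : X) (l : List (Fin θ)) {v : Fin θ → ℤ} (hv : v ≠ 0) :
    R.wordMap x l v ≠ 0 := fun h => hv <| by
  rw [← R.wordMap_reverse_wordMap x l v, h, (R.wordMap_isLinearMap _ _).map_zero]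

theorem encard_posOn_wordEnd {J : Set (Fin θ)} (x : X) {l : List (Fin θ)} (hl : ∀ i ∈ l, i ∈ J) :
    (R.posOn J (R.wordEnd x l)).encard = (R.posOn J x).encard := by
  induction l generalizing x with
  | nil => rfl
  | cons i l ih =>
    exact (ih (R.ρ i x) fun j hj => hl j (by simp [hj])).trans
      (R.encard_posOn_ρ (hl i (by simp)) x)

end Words

section Inversions

variable {θ : ℕ} {X : Type*} (R : GRS θ X)

/-- The positive roots that a map `g` sends out of the positive cone. -/
def inv (g : (Fin θ → ℤ) → (Fin θ → ℤ)) (y : X) : Set (Fin θ → ℤ) :=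
  {v ∈ R.posOn Set.univ y | ∃ k, g v k < 0}

/-- The inversions of the Weyl groupoid element represented by a word. -/
def wordInv (x : X) (l : List (Fin θ)) : Set (Fin θ → ℤ) :=
  R.inv (R.wordMap x l) (R.wordEnd x l)

variable {R}

theorem WordEq.wordInv_eq {x : X} {l l' : List (Fin θ)} (h : R.WordEq x l l') :
    R.wordInv x l = R.wordInv x l' := by
  rw [wordInv, wordInv, h.1, h.2]

variable (R)

theorem wordInv_nil (x : X) : R.wordInv x [] = ∅ := by
  refine Set.eq_empty_of_forall_notMem fun v hv => ?_
  obtain ⟨hv, k, hk⟩ := hv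
  exact absurd (hv.2.1 k) (not_le.2 hk)

variable {R}

theorem nonpos_of_mem_wordInv {x : X} {l : List (Fin θ)} {v : Fin θ → ℤ}
    (h : v ∈ R.wordInv x l) (k : Fin θ) : R.wordMap x l v k ≤ 0 := by
  obtain ⟨hv, k', hk'⟩ := h
  exact (R.nonneg_or_nonpos (R.wordMap_mem x l hv.1)).resolve_left
    (fun h0 => absurd (h0 k') (not_le.2 hk')) k

theorem nonneg_of_notMem_wordInv {x : X} {l : List (Fin θ)} {v : Fin θ → ℤ}
    (hv : v ∈ R.posOn Set.univ (R.wordEnd x l)) (h : v ∉ R.wordInv x l) (k : Fin θ) :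
    0 ≤ R.wordMap x l v k :=
  not_lt.1 fun hk => h ⟨hv, k, hk⟩

theorem mem_wordInv_of_nonpos {x : X} {l : List (Fin θ)} {v : Fin θ → ℤ}
    (hv : v ∈ R.posOn Set.univ (R.wordEnd x l)) (h : ∀ k, R.wordMap x l v k ≤ 0) :
    v ∈ R.wordInv x l := by
  refine ⟨hv, ?_⟩
  by_contra! h0
  obtain ⟨k, hk⟩ := hv.2.2.1
  refine R.wordMap_ne_zero x l (fun hz => ?_) (funext fun k => le_antisymm (h k) (h0 k))
  rw [hz] at hk
  exact lt_irrefl _ hk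

theorem posOn_univ_of_posOn {J : Set (Fin θ)} {x : X} {v : Fin θ → ℤ} (h : v ∈ R.posOn J x) :
    v ∈ R.posOn Set.univ x :=
  ⟨h.1, h.2.1, h.2.2.1, fun k hk => absurd (Set.mem_univ k) hk⟩

theorem posOn_subset_wordInv {J : Set (Fin θ)} {x : X} {l : List (Fin θ)}
    (h : ∀ i ∈ J, Pi.single i 1 ∈ R.wordInv x l) : R.posOn J (R.wordEnd x l) ⊆ R.wordInv x l := by
  intro v hv
  refine mem_wordInv_of_nonpos (posOn_univ_of_posOn hv) fun k => ?_
  rw [wordMap_eq_sum, Finset.sum_apply]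
  refine Finset.sum_nonpos fun i _ => ?_
  by_cases hi : i ∈ J
  · exact mul_nonpos_of_nonneg_of_nonpos (hv.2.1 i) (nonpos_of_mem_wordInv (h i hi) k)
  · simp [hv.2.2.2 i hi]

theorem wordInv_subset_posOn {J : Set (Fin θ)} {x : X} {l : List (Fin θ)} (hl : ∀ i ∈ l, i ∈ J) :
    R.wordInv x l ⊆ R.posOn J (R.wordEnd x l) := by
  refine fun v hv => ⟨hv.1.1, hv.1.2.1, hv.1.2.2.1, fun k hk => le_antisymm ?_ (hv.1.2.1 k)⟩
  rw [← R.wordMap_apply_of_notMem x hl v hk]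
  exact nonpos_of_mem_wordInv hv k

theorem single_mem_wordInv_append_iff {x : X} {l : List (Fin θ)} {i : Fin θ} :
    Pi.single i 1 ∈ R.wordInv x (l ++ [i]) ↔ Pi.single i 1 ∉ R.wordInv x l := by
  have h : R.wordMap x (l ++ [i]) (Pi.single i 1) = -R.wordMap x l (Pi.single i 1) := by
    rw [wordMap_append, wordMap_singleton, Function.comp_apply, R.cartanRefl_self,
      (R.wordMap_isLinearMap x l).map_neg]
  constructor
  · intro h1 h2
    obtain ⟨-, k, hk⟩ := h1
    have := nonpos_of_mem_wordInv h2 k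
    rw [h, Pi.neg_apply] at hk
    omega
  · intro h1
    refine mem_wordInv_of_nonpos (R.single_mem_posOn (Set.mem_univ i) _) fun k => ?_
    have := nonneg_of_notMem_wordInv (R.single_mem_posOn (Set.mem_univ i) _) h1 k
    rw [h, Pi.neg_apply]
    omega

theorem wordInv_append_diff (x : X) (l : List (Fin θ)) (i : Fin θ) :
    R.wordInv x (l ++ [i]) \ {Pi.single i 1} =
      cartanRefl (R.C (R.wordEnd x l)) i '' (R.wordInv x l \ {Pi.single i 1}) := by
  have h : ∀ v, R.wordMap x (l ++ [i]) v =
      R.wordMap x l (cartanRefl (R.C (R.wordEnd x l)) i v) := fun v => by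
    rw [wordMap_append, wordMap_singleton, Function.comp_apply]
  have hp := R.posOn_ρ (Set.mem_univ i) (R.wordEnd x l)
  have he : R.wordEnd x (l ++ [i]) = R.ρ i (R.wordEnd x l) := by
    rw [wordEnd_append, wordEnd_singleton]
  ext v
  constructor
  · rintro ⟨⟨hv, k, hk⟩, hne⟩
    obtain ⟨w, ⟨hw, hwne⟩, rfl⟩ := (Set.ext_iff.1 hp v).1 ⟨he ▸ hv, hne⟩
    refine ⟨w, ⟨⟨hw, k, ?_⟩, hwne⟩, rfl⟩
    rwa [h, R.cartanRefl_cartanRefl] at hk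
  · rintro ⟨w, ⟨⟨hw, k, hk⟩, hwne⟩, rfl⟩
    have := (Set.ext_iff.1 hp _).2 ⟨w, ⟨hw, hwne⟩, rfl⟩
    refine ⟨⟨he ▸ this.1, k, ?_⟩, this.2⟩
    rwa [h, R.cartanRefl_cartanRefl]

theorem encard_wordInv_append {x : X} {l : List (Fin θ)} {i : Fin θ}
    (h : Pi.single i 1 ∉ R.wordInv x l) :
    (R.wordInv x (l ++ [i])).encard = (R.wordInv x l).encard + 1 := by
  rw [← Set.encard_sdiff_singleton_add_one (single_mem_wordInv_append_iff.2 h),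
    wordInv_append_diff, (R.cartanRefl_injective _ i).encard_image, Set.sdiff_singleton_eq_self h]

theorem wordEq_append_pair (x : X) (l : List (Fin θ)) (i : Fin θ) :
    R.WordEq x (l ++ [i] ++ [i]) l := by
  simpa using (R.wordEq_pair (R.wordEnd x l) i).append_left l

theorem encard_wordInv_append_add_one {x : X} {l : List (Fin θ)} {i : Fin θ}
    (h : Pi.single i 1 ∈ R.wordInv x l) :
    (R.wordInv x (l ++ [i])).encard + 1 = (R.wordInv x l).encard := by
  rw [← encard_wordInv_append fun h' => single_mem_wordInv_append_iff.1 h' h,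
    (wordEq_append_pair x l i).wordInv_eq]

theorem encard_wordInv_le (x : X) (l : List (Fin θ)) : (R.wordInv x l).encard ≤ l.length := by
  induction l using List.reverseRecOn with
  | nil => simp [wordInv_nil]
  | append_singleton l i ih =>
    by_cases h : Pi.single i 1 ∈ R.wordInv x l
    · rw [← encard_wordInv_append_add_one h] at ih
      refine le_self_add.trans (ih.trans ?_)
      simp
    · rw [encard_wordInv_append h]
      simpa using add_le_add_left ih 1

theorem wordInv_reverse_append {J : Set (Fin θ)} {x : X} {l l' : List (Fin θ)}
    (hl : ∀ i ∈ l, i ∈ J) (hl' : ∀ i ∈ l', i ∈ J)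
    (h : R.posOn J (R.wordEnd x l) ⊆ R.wordInv x l)
    (h' : R.posOn J (R.wordEnd x l') ⊆ R.wordInv x l') :
    R.wordInv (R.wordEnd x l') (l'.reverse ++ l) = ∅ := by
  refine Set.eq_empty_of_forall_notMem fun v hv => ?_
  have hvJ := wordInv_subset_posOn (J := J) (by simpa [or_imp, forall_and] using ⟨hl', hl⟩) hv
  have hmap : R.wordMap (R.wordEnd x l') (l'.reverse ++ l) v =
      R.wordMap (R.wordEnd x l') l'.reverse (R.wordMap x l v) := by
    rw [wordMap_append, wordEnd_reverse, Function.comp_apply]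
  have hend : R.wordEnd (R.wordEnd x l') (l'.reverse ++ l) = R.wordEnd x l := by
    rw [wordEnd_append, wordEnd_reverse]
  obtain ⟨hv0, k, hk⟩ := hv
  have hnp := nonpos_of_mem_wordInv ⟨hv0, k, hk⟩
  have hmem := R.wordMap_mem _ _ hv0.1
  rw [hend] at hvJ
  rw [hmap] at hk hnp hmem
  set w := R.wordMap (R.wordEnd x l') l'.reverse (R.wordMap x l v) with hw
  have hwJ : -w ∈ R.posOn J (R.wordEnd x l') := by
    refine ⟨R.neg_mem hmem, fun k => by simpa using hnp k, ⟨k, by simpa using hk⟩, fun j hj => ?_⟩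
    rw [Pi.neg_apply, hw, R.wordMap_apply_of_notMem _ (by simpa using hl') _ hj,
      R.wordMap_apply_of_notMem _ hl _ hj, hvJ.2.2.2 j hj, neg_zero]
  obtain ⟨-, k', hk'⟩ := h' hwJ
  have := nonpos_of_mem_wordInv (h hvJ) k'
  rw [(R.wordMap_isLinearMap x l').map_neg, hw, R.wordMap_wordMap_reverse, Pi.neg_apply] at hk'
  omega

end Inversions

section RankTwo

variable {θ : ℕ} {X : Type*} {R : GRS θ X}

/-- The alternating word `i, j, i, j, …` with `n` letters. -/
def alt (i j : Fin θ) (n : ℕ) : List (Fin θ) :=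
  (List.range n).map fun k => if Even k then i else j

theorem alt_succ (i j : Fin θ) (n : ℕ) :
    alt i j (n + 1) = alt i j n ++ [if Even n then i else j] := by
  simp [alt, List.range_succ]

theorem alt_succ' (i j : Fin θ) (n : ℕ) : alt i j (n + 1) = i :: alt j i n := by
  simp only [alt, List.range_succ_eq_map, List.map_cons, List.map_map, Even.zero, if_true]
  congr 1
  refine List.map_congr_left fun k _ => ?_
  by_cases h : Even k <;> simp [Nat.even_add_one, h]

theorem mem_pair_of_mem_alt {i j k : Fin θ} {n : ℕ} (h : k ∈ alt i j n) :
    k ∈ ({i, j} : Set (Fin θ)) := by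
  obtain ⟨a, -, rfl⟩ := List.mem_map.1 h
  by_cases ha : Even a <;> simp [ha]

theorem wordEnd_alt (i j : Fin θ) (n : ℕ) (y : X) :
    R.wordEnd y (alt j i n) = R.wordEnd (((R.ρ i * R.ρ j) ^ n) y) (alt i j n) := by
  induction n generalizing i j y with
  | zero => rfl
  | succ n ih =>
    rw [alt_succ', alt_succ']
    change R.wordEnd (R.ρ j y) (alt i j n) = R.wordEnd (R.ρ i _) (alt j i n)
    rw [ih]
    congr 1
    rw [pow_succ', Equiv.Perm.mul_apply, Equiv.Perm.mul_apply, R.ρ_ρ]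
    exact congrArg (fun e : Equiv.Perm X => e y) (mul_pow_mul (R.ρ j) (R.ρ i) n)

theorem encard_wordInv_alt_and_single_notMem {i j : Fin θ} {y : X} {m : ℕ}
    (hm : (R.posOn {i, j} y).encard = m) {n : ℕ} (hn : n ≤ m) :
    (R.wordInv y (alt i j n)).encard = n ∧
      ∀ k, n = k + 1 → Pi.single (if Even k then i else j) 1 ∈ R.wordInv y (alt i j n) ∧
        (n < m → Pi.single (if Even n then i else j) 1 ∉ R.wordInv y (alt i j n)) := by
  induction n with
  | zero => exact ⟨by simp [alt, wordInv_nil], by simp⟩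
  | succ n ih =>
    obtain ⟨hc, hk⟩ := ih (by omega)
    have hnot : Pi.single (if Even n then i else j) 1 ∉ R.wordInv y (alt i j n) := by
      cases n with
      | zero => simp [alt, wordInv_nil]
      | succ n => exact (hk n rfl).2 (by omega)
    have hmem := single_mem_wordInv_append_iff.2 hnot
    have hc' := encard_wordInv_append hnot
    rw [← alt_succ] at hmem hc'
    rw [hc] at hc'
    refine ⟨by simpa using hc', fun k hk => ?_⟩
    obtain rfl : n = k := by omega
    refine ⟨hmem, fun hlt hmem' => ?_⟩
    have hsub : R.posOn {i, j} (R.wordEnd y (alt i j (n + 1))) ⊆ R.wordInv y (alt i j (n + 1)) := by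
      refine posOn_subset_wordInv fun a ha => ?_
      by_cases he : Even n <;> simp only [he, Nat.even_add_one, not_true, not_false_iff, if_true,
        if_false] at hmem hmem' <;> rcases ha with rfl | rfl <;> assumption
    have hle := Set.encard_le_encard hsub
    rw [R.encard_posOn_wordEnd y fun _ => mem_pair_of_mem_alt, hm, hc'] at hle
    norm_cast at hle
    omega

theorem encard_wordInv_alt {i j : Fin θ} {y : X} {m : ℕ}
    (hm : (R.posOn {i, j} y).encard = m) {n : ℕ} (hn : n ≤ m) :
    (R.wordInv y (alt i j n)).encard = n :=
  (encard_wordInv_alt_and_single_notMem hm hn).1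

theorem single_notMem_wordInv_alt {i j : Fin θ} {y : X} {m : ℕ}
    (hm : (R.posOn {i, j} y).encard = m) {n : ℕ} (hn : n < m) :
    Pi.single (if Even n then i else j) 1 ∉ R.wordInv y (alt i j n) := by
  cases n with
  | zero => simp [alt, wordInv_nil]
  | succ n => exact ((encard_wordInv_alt_and_single_notMem hm hn.le).2 n rfl).2 hn

theorem posOn_subset_wordInv_alt {i j : Fin θ} {y : X} {m : ℕ}
    (hm : (R.posOn {i, j} y).encard = m) :
    R.posOn {i, j} (R.wordEnd y (alt i j m)) ⊆ R.wordInv y (alt i j m) := by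
  have hsub : R.wordInv y (alt i j m) ⊆ R.posOn {i, j} (R.wordEnd y (alt i j m)) :=
    wordInv_subset_posOn fun _ => mem_pair_of_mem_alt
  have hp : (R.posOn {i, j} (R.wordEnd y (alt i j m))).encard = m := by
    rw [R.encard_posOn_wordEnd y fun _ => mem_pair_of_mem_alt, hm]
  refine ((Set.finite_of_encard_eq_coe hp).eq_of_subset_of_encard_le' hsub ?_).ge
  rw [hp, encard_wordInv_alt hm le_rfl]

theorem posOn_pair_eq {i j : Fin θ} (hij : i ≠ j) (y : X) :
    R.posOn {i, j} y =
      R.Δ y ∩ {v | ∃ p q : ℕ, v = p • (Pi.single i 1 : Fin θ → ℤ) + q • Pi.single j 1} := by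
  ext v
  constructor
  · rintro ⟨hv, h0, -, hJ⟩
    refine ⟨hv, (v i).toNat, (v j).toNat, funext fun k => ?_⟩
    by_cases hi : k = i
    · subst hi
      simp [hij, h0]
    by_cases hj : k = j
    · subst hj
      simp [hi, h0]
    simpa [hi, hj] using hJ k (by simp [hi, hj])
  · rintro ⟨hv, p, q, hpq⟩
    have h0 : ∀ k, 0 ≤ v k := fun k => by
      rw [hpq]
      have h : ∀ a : Fin θ, (0 : Fin θ → ℤ) ≤ Pi.single a 1 := fun a => by simp
      exact add_nonneg (nsmul_nonneg (h i k) p) (nsmul_nonneg (h j k) q)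
    refine ⟨hv, h0, ?_, fun k hk => ?_⟩
    · by_contra! hle
      exact R.ne_zero_of_mem i hv (funext fun k => le_antisymm (hle k) (h0 k))
    · simp only [Set.mem_insert_iff, Set.mem_singleton_iff, not_or] at hk
      simp [hpq, hk.1, hk.2]

theorem minor_wordMap (i j : Fin θ) (hij : i ≠ j) (x : X) {l : List (Fin θ)}
    (hl : ∀ k ∈ l, k ∈ ({i, j} : Set (Fin θ))) :
    R.wordMap x l (Pi.single i 1) i * R.wordMap x l (Pi.single j 1) j -
      R.wordMap x l (Pi.single i 1) j * R.wordMap x l (Pi.single j 1) i = (-1) ^ l.length := by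
  induction l using List.reverseRecOn with
  | nil => simp [wordMap, hij]
  | append_singleton l k ih =>
    have ih := ih fun a ha => hl a (by simp [ha])
    have hlin := R.wordMap_isLinearMap x l
    simp only [wordMap_append, wordMap_singleton, Function.comp_apply, List.length_append,
      List.length_singleton, pow_succ, ← ih]
    rcases hl k (by simp) with rfl | rfl <;>
    · rw [R.cartanRefl_self, cartanRefl_single, hlin.map_neg, hlin.map_sub, hlin.map_smul]
      simp only [Pi.neg_apply, Pi.sub_apply, Pi.smul_apply, smul_eq_mul]
      ring

theorem wordMap_eq_self {i j : Fin θ} (hij : i ≠ j) {z : X} {l : List (Fin θ)}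
    (hl : ∀ k ∈ l, k ∈ ({i, j} : Set (Fin θ))) (hz : R.wordEnd z l = z) (heven : Even l.length)
    (hinv : R.wordInv z l = ∅) (hinv' : R.wordInv z l.reverse = ∅) (v : Fin θ → ℤ) :
    R.wordMap z l v = v := by
  have hz' : R.wordEnd z l.reverse = z := by simpa [hz] using R.wordEnd_reverse z l
  have hl' : ∀ k ∈ l.reverse, k ∈ ({i, j} : Set (Fin θ)) := by simpa using hl
  have hnonneg : ∀ k a, 0 ≤ R.wordMap z l (Pi.single k 1) a := fun k =>
    nonneg_of_notMem_wordInv (R.single_mem_posOn (Set.mem_univ k) _) (by simp [hinv])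
  have hnonneg' : ∀ k a, 0 ≤ R.wordMap z l.reverse (Pi.single k 1) a := fun k =>
    nonneg_of_notMem_wordInv (R.single_mem_posOn (Set.mem_univ k) _) (by simp [hinv'])
  have hdet := minor_wordMap (R := R) i j hij z hl
  have hdet' := minor_wordMap (R := R) i j hij z hl'
  rw [heven.neg_one_pow] at hdet
  rw [List.length_reverse, heven.neg_one_pow] at hdet'
  have hdec : ∀ v, R.wordMap z l v = v + (R.wordMap z l v i - v i) • Pi.single i 1 +
      (R.wordMap z l v j - v j) • Pi.single j 1 := fun v => funext fun k => by
    by_cases hi : k = i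
    · subst hi
      simp [hij]
    by_cases hj : k = j
    · subst hj
      simp [hi]
    simpa [hi, hj] using R.wordMap_apply_of_notMem z hl v (k := k) (by simp [hi, hj])
  have hcomp : ∀ v a, R.wordMap z l.reverse v a +
      (R.wordMap z l v i - v i) * R.wordMap z l.reverse (Pi.single i 1) a +
      (R.wordMap z l v j - v j) * R.wordMap z l.reverse (Pi.single j 1) a = v a := fun v a => by
    have h := R.wordMap_reverse_wordMap z l v
    have hlin := R.wordMap_isLinearMap z l.reverse
    rw [hz, hdec v, hlin.map_add, hlin.map_add, hlin.map_smul, hlin.map_smul] at h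
    simpa using congrFun h a
  have hii := hcomp (Pi.single i 1) i
  have hij' := hcomp (Pi.single i 1) j
  have hji := hcomp (Pi.single j 1) i
  have hjj := hcomp (Pi.single j 1) j
  simp only [Pi.single_eq_same, Pi.single_eq_of_ne hij, Pi.single_eq_of_ne hij.symm, sub_zero]
    at hii hij' hji hjj
  have hp := hnonneg i i
  have hq := hnonneg i j
  have hr := hnonneg j i
  have hs := hnonneg j j
  have hp' := hnonneg' i i
  have hq' := hnonneg' i j
  have hr' := hnonneg' j i
  have hs' := hnonneg' j j
  have hq0 : R.wordMap z l (Pi.single i 1) j = 0 := by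
    by_contra hne
    have h1 : 0 < R.wordMap z l (Pi.single i 1) j := lt_of_le_of_ne hq (Ne.symm hne)
    have h2 : R.wordMap z l.reverse (Pi.single j 1) j = 0 := by
      by_contra hne'
      have h3 := mul_pos h1 (lt_of_le_of_ne hs' (Ne.symm hne'))
      nlinarith [mul_nonneg hp hq']
    rw [h2] at hdet'
    nlinarith [mul_nonneg hq' hr']
  have hr0 : R.wordMap z l (Pi.single j 1) i = 0 := by
    by_contra hne
    have h1 : 0 < R.wordMap z l (Pi.single j 1) i := lt_of_le_of_ne hr (Ne.symm hne)
    have h2 : R.wordMap z l.reverse (Pi.single i 1) i = 0 := by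
      by_contra hne'
      have h3 := mul_pos h1 (lt_of_le_of_ne hp' (Ne.symm hne'))
      nlinarith [mul_nonneg hs hr']
    rw [h2] at hdet'
    nlinarith [mul_nonneg hq' hr']
  rw [hq0, hr0, zero_mul, sub_zero] at hdet
  have hp1 := Int.eq_one_of_mul_eq_one_right hp hdet
  have hs1 := Int.eq_one_of_mul_eq_one_left hs hdet
  simp only [hq0, hr0, hp1, hs1, sub_self, zero_mul, add_zero] at hii hij' hji hjj
  have hsingle : ∀ k, R.wordMap z l (Pi.single k 1) = Pi.single k 1 := fun k => by
    rw [hdec]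
    by_cases hi : k = i
    · subst hi
      simp [hp1, hq0, hij]
    by_cases hj : k = j
    · subst hj
      simp [hs1, hr0, hij]
    have hki := hcomp (Pi.single k 1) i
    have hkj := hcomp (Pi.single k 1) j
    rw [hii, hji, Pi.single_eq_of_ne (Ne.symm hi)] at hki
    rw [hij', hjj, Pi.single_eq_of_ne (Ne.symm hj)] at hkj
    have h1 := hnonneg k i
    have h2 := hnonneg k j
    have h3 := hnonneg' k i
    have h4 := hnonneg' k j
    have h5 : R.wordMap z l (Pi.single k 1) i = 0 := by linarith
    have h6 : R.wordMap z l (Pi.single k 1) j = 0 := by linarith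
    simp [h5, h6, Ne.symm hi, Ne.symm hj]
  rw [wordMap_eq_sum]
  simp only [hsingle]
  exact (pi_eq_sum_univ' v).symm

theorem wordEq_alt {i j : Fin θ} (hij : i ≠ j) {y : X} {m : ℕ}
    (hm : (R.posOn {i, j} y).encard = m) : R.WordEq y (alt i j m) (alt j i m) := by
  have hm' : (R.posOn {j, i} y).encard = m := by rwa [Set.pair_comm]
  have hcox : ((R.ρ i * R.ρ j) ^ m) y = y := by
    have hfin := Set.finite_of_encard_eq_coe hm
    have hcard : (R.posOn {i, j} y).ncard = m := by rw [Set.ncard, hm, ENat.toNat_natCast]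
    rw [posOn_pair_eq hij] at hfin hcard
    simpa only [hcard] using R.root_coxeter y i j hij hfin
  have hend : R.wordEnd y (alt j i m) = R.wordEnd y (alt i j m) := by rw [wordEnd_alt, hcox]
  have hmem : ∀ k ∈ alt i j m, k ∈ ({i, j} : Set (Fin θ)) := fun _ => mem_pair_of_mem_alt
  have hmem' : ∀ k ∈ alt j i m, k ∈ ({i, j} : Set (Fin θ)) := fun _ h =>
    Set.pair_comm j i ▸ mem_pair_of_mem_alt h
  have hsub := posOn_subset_wordInv_alt hm
  have hsub' := posOn_subset_wordInv_alt hm'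
  rw [Set.pair_comm] at hsub'
  have hinv := wordInv_reverse_append hmem hmem' hsub hsub'
  have hinv' := wordInv_reverse_append hmem' hmem hsub' hsub
  refine ⟨hend.symm, funext fun v => ?_⟩
  have hid := wordMap_eq_self hij (z := R.wordEnd y (alt j i m))
    (l := (alt j i m).reverse ++ alt i j m) (by
      intro k hk
      rcases List.mem_append.1 hk with hk | hk
      · exact hmem' k (List.mem_reverse.1 hk)
      · exact hmem k hk)
    (by rw [wordEnd_append, wordEnd_reverse, hend]) (by simp [alt]) hinv
    (by simpa [hend] using hinv') v
  rw [wordMap_append, wordEnd_reverse, Function.comp_apply] at hid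
  rw [← R.wordMap_wordMap_reverse y (alt j i m) (R.wordMap y (alt i j m) v), hid]

end RankTwo

section Exchange

variable {θ : ℕ} {X : Type*} {R : GRS θ X}

theorem single_mem_wordInv_append_alt {x : X} {l : List (Fin θ)} {i j : Fin θ} {m : ℕ}
    (hm : (R.posOn {i, j} (R.wordEnd x l)).encard = m) (hi : Pi.single i 1 ∈ R.wordInv x l)
    (hj : Pi.single j 1 ∈ R.wordInv x l) {n : ℕ} (hn : n < m) :
    Pi.single (if Even n then i else j) 1 ∈ R.wordInv x (l ++ alt i j n) := by
  set c := if Even n then i else j with hc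
  have hnot := single_notMem_wordInv_alt hm hn
  have hc' : Pi.single c 1 ∈ R.posOn {i, j} (R.wordEnd (R.wordEnd x l) (alt i j n)) :=
    R.single_mem_posOn (by by_cases h : Even n <;> simp [hc, h]) _
  have hnn := nonneg_of_notMem_wordInv (posOn_univ_of_posOn hc') hnot
  have hβ : R.wordMap (R.wordEnd x l) (alt i j n) (Pi.single c 1) ∈
      R.posOn {i, j} (R.wordEnd x l) := by
    refine ⟨R.wordMap_mem _ _ hc'.1, hnn, ?_, fun k hk => ?_⟩
    · by_contra! hle
      exact R.wordMap_ne_zero _ _ (R.ne_zero_of_mem i hc'.1)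
        (funext fun k => le_antisymm (hle k) (hnn k))
    · rw [R.wordMap_apply_of_notMem _ (fun _ => mem_pair_of_mem_alt) _ hk]
      exact hc'.2.2.2 k hk
  refine mem_wordInv_of_nonpos (R.single_mem_posOn (Set.mem_univ c) _) fun k => ?_
  rw [wordMap_append]
  refine nonpos_of_mem_wordInv (posOn_subset_wordInv (fun a ha => ?_) hβ) k
  rcases ha with rfl | rfl <;> assumption

theorem encard_wordInv_append_alt {x : X} {l : List (Fin θ)} {i j : Fin θ} {m : ℕ}
    (hm : (R.posOn {i, j} (R.wordEnd x l)).encard = m) (hi : Pi.single i 1 ∈ R.wordInv x l)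
    (hj : Pi.single j 1 ∈ R.wordInv x l) {n : ℕ} (hn : n ≤ m) :
    (R.wordInv x (l ++ alt i j n)).encard + n = (R.wordInv x l).encard := by
  induction n with
  | zero => simp [alt]
  | succ n ih =>
    rw [← ih (by omega), alt_succ, ← List.append_assoc, ← encard_wordInv_append_add_one
      (single_mem_wordInv_append_alt hm hi hj hn)]
    push_cast
    ring

/-- The exchange property: a right descent of a reduced word can be moved to its end. -/
theorem exists_wordEq_append_singleton (hfin : ∀ y, (R.posOn Set.univ y).Finite) {x : X}
    {l : List (Fin θ)} {i : Fin θ} (hred : (R.wordInv x l).encard = l.length)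
    (hi : Pi.single i 1 ∈ R.wordInv x l) :
    ∃ l' : List (Fin θ), l'.length + 1 = l.length ∧ R.WordEq x l (l' ++ [i]) := by
  induction hn : l.length using Nat.strong_induction_on generalizing l i with
  | _ n IH =>
  rcases List.eq_nil_or_concat' l with rfl | ⟨l₁, j, rfl⟩
  · simp [wordInv_nil] at hi
  by_cases hij : j = i
  · subst hij
    exact ⟨l₁, by simpa using hn, rfl, rfl⟩
  set l := l₁ ++ [j] with hl
  have hj : Pi.single j 1 ∈ R.wordInv x l := by
    refine single_mem_wordInv_append_iff.2 fun hmem => ?_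
    have h1 := encard_wordInv_append_add_one hmem
    have h2 := encard_wordInv_le (R := R) x l₁
    rw [← h1, hred, hl] at h2
    simp only [List.length_append, List.length_singleton] at h2
    norm_cast at h2
    omega
  obtain ⟨m, hm⟩ := ((hfin (R.wordEnd x l)).subset fun v hv =>
    posOn_univ_of_posOn (J := {j, i}) hv).exists_encard_eq_coe
  have hm0 : m ≠ 0 := by
    rintro rfl
    rw [Nat.cast_zero, Set.encard_eq_zero] at hm
    exact Set.notMem_empty _ (hm ▸ R.single_mem_posOn (J := {j, i}) (by simp) _ :
      Pi.single i 1 ∈ _)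
  have hdesc : ∀ k, k + 1 ≤ m → ∃ t : List (Fin θ), t.length + (k + 1) = n ∧
      R.WordEq x (l ++ alt j i (k + 1)) t := fun k => by
    induction k with
    | zero =>
      intro _
      refine ⟨l₁, by simpa [hl] using hn, ?_⟩
      simpa [alt, hl] using wordEq_append_pair x l₁ j
    | succ k ih =>
      intro hk
      obtain ⟨t, ht, hlt⟩ := ih (by omega)
      have hcard := encard_wordInv_append_alt hm hj hi (n := k + 1) (by omega)
      have hmem := single_mem_wordInv_append_alt hm hj hi (n := k + 1) (by omega)
      rw [hlt.wordInv_eq] at hcard hmem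
      have htred : (R.wordInv x t).encard = t.length := by
        rw [hred, hn, ← ht, Nat.cast_add] at hcard
        exact ENat.add_left_injective_of_ne_top (ENat.natCast_ne_top _) hcard
      obtain ⟨t', ht', htt'⟩ := IH t.length (by omega) htred hmem rfl
      refine ⟨t', by omega, ?_⟩
      rw [alt_succ, ← List.append_assoc]
      exact ((hlt.append_right _).trans (htt'.append_right _)).trans (wordEq_append_pair x t' _)
  obtain ⟨m, rfl⟩ := Nat.exists_eq_succ_of_ne_zero hm0
  obtain ⟨t, ht, hlt⟩ := hdesc m le_rfl
  refine ⟨t ++ (alt j i m).reverse, by simp [alt]; omega, ?_⟩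
  have h1 : R.WordEq x (l ++ (alt i j (m + 1) ++ (alt i j (m + 1)).reverse)) (l ++ []) :=
    (R.wordEq_append_reverse _ _).append_left l
  have h2 : R.WordEq x (l ++ (alt i j (m + 1) ++ (alt i j (m + 1)).reverse))
      (l ++ (alt j i (m + 1) ++ (alt i j (m + 1)).reverse)) :=
    ((wordEq_alt hij hm).symm.append_right _).append_left l
  have h3 := hlt.append_right (alt i j (m + 1)).reverse
  rw [List.append_nil] at h1
  rw [← List.append_assoc l (alt j i _)] at h2
  have h4 := h1.symm.trans (h2.trans h3)
  rwa [alt_succ', List.reverse_cons, ← List.append_assoc] at h4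

theorem exists_reduced (hfin : ∀ y, (R.posOn Set.univ y).Finite) (x : X) (l : List (Fin θ)) :
    ∃ l', R.WordEq x l l' ∧ (R.wordInv x l').encard = l'.length := by
  induction l using List.reverseRecOn with
  | nil => exact ⟨[], ⟨rfl, rfl⟩, by simp [wordInv_nil]⟩
  | append_singleton l i ih =>
    obtain ⟨t, hlt, ht⟩ := ih
    by_cases hi : Pi.single i 1 ∈ R.wordInv x t
    · obtain ⟨t', ht', htt'⟩ := exists_wordEq_append_singleton hfin ht hi
      have h := ((hlt.append_right [i]).trans (htt'.append_right [i])).trans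
        (wordEq_append_pair x t' i)
      refine ⟨t', h, ?_⟩
      have hcard := encard_wordInv_append_add_one hi
      rw [← (hlt.append_right [i]).wordInv_eq, h.wordInv_eq, ht, ← ht', Nat.cast_add,
        Nat.cast_one] at hcard
      exact ENat.add_left_injective_of_ne_top ENat.one_ne_top hcard
    · exact ⟨t ++ [i], hlt.append_right [i], by simp [encard_wordInv_append hi, ht]⟩

theorem coe_len (hfin : ∀ y, (R.posOn Set.univ y).Finite) (x : X) (l : List (Fin θ)) :
    (R.len x (R.wordMap x l) (R.wordEnd x l) : ℕ∞) = (R.wordInv x l).encard := by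
  obtain ⟨t, hlt, ht⟩ := exists_reduced hfin x l
  rw [hlt.wordInv_eq, ht, Nat.cast_inj]
  apply le_antisymm
  · exact Nat.sInf_le ⟨t, rfl, hlt.1.symm, hlt.2.symm⟩
  · refine le_csInf ⟨_, t, rfl, hlt.1.symm, hlt.2.symm⟩ ?_
    rintro _ ⟨s, rfl, hs1, hs2⟩
    have h := encard_wordInv_le (R := R) x s
    rw [WordEq.wordInv_eq (⟨hs1, hs2⟩ : R.WordEq x s l), hlt.wordInv_eq, ht] at h
    exact_mod_cast h

end Exchange

section Longest

variable {θ : ℕ} {X : Type*} {R : GRS θ X}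

theorem exists_posOn_subset_wordInv (hfin : R.FiniteWeyl) (x : X) :
    ∃ l : List (Fin θ), R.posOn Set.univ (R.wordEnd x l) ⊆ R.wordInv x l := by
  have hf : (Set.range fun l => (R.wordInv x l).encard).Finite := by
    refine (hfin.image fun p => (R.inv p.2.1 p.2.2).encard).subset ?_
    rintro _ ⟨l, rfl⟩
    exact ⟨(x, R.wordMap x l, R.wordEnd x l), R.weyl_iff.2 ⟨l, rfl, rfl⟩, rfl⟩
  obtain ⟨_, ⟨l, rfl⟩, hl⟩ := hf.exists_maximal ⟨_, [], rfl⟩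
  refine ⟨l, posOn_subset_wordInv fun i _ => by_contra fun hi => ?_⟩
  have hle := hl ⟨l ++ [i], rfl⟩ (by simp [encard_wordInv_append hi])
  simp only [encard_wordInv_append hi] at hle
  have hne : (R.wordInv x l).encard ≠ ⊤ :=
    ((encard_wordInv_le x l).trans_lt (ENat.natCast_lt_top _)).ne
  exact absurd ((ENat.add_one_le_iff hne).1 hle) (lt_irrefl _)

theorem finite_posOn_univ (hfin : R.FiniteWeyl) (x : X) : (R.posOn Set.univ x).Finite := by
  obtain ⟨l, hl⟩ := exists_posOn_subset_wordInv hfin x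
  rw [← Set.encard_lt_top_iff, ← R.encard_posOn_wordEnd x fun i _ => Set.mem_univ i]
  exact (Set.encard_le_encard hl).trans_lt
    ((encard_wordInv_le x l).trans_lt (ENat.natCast_lt_top _))

theorem encard_posOn_univ_eq (x y : X) :
    (R.posOn Set.univ x).encard = (R.posOn Set.univ y).encard := by
  induction R.connected x y with
  | refl => rfl
  | tail _ h ih =>
    obtain ⟨i, rfl⟩ := h
    rw [ih, R.encard_posOn_ρ (Set.mem_univ i)]

theorem wordEq_of_posOn_subset_wordInv (hfin : R.FiniteWeyl) {x : X} {l l' : List (Fin θ)}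
    (h : R.posOn Set.univ (R.wordEnd x l) ⊆ R.wordInv x l)
    (h' : R.posOn Set.univ (R.wordEnd x l') ⊆ R.wordInv x l') : R.WordEq x l l' := by
  have hinv := wordInv_reverse_append (fun i _ => Set.mem_univ i) (fun i _ => Set.mem_univ i) h h'
  obtain ⟨t, ht, hred⟩ := exists_reduced (finite_posOn_univ hfin) (R.wordEnd x l')
    (l'.reverse ++ l)
  rw [← ht.wordInv_eq, hinv, Set.encard_empty] at hred
  obtain rfl : t = [] := List.length_eq_zero_iff.1 (by exact_mod_cast hred.symm)
  have h1 := ht.append_left l'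
  have h2 := (R.wordEq_append_reverse x l').append_right l
  simp only [List.append_assoc, List.nil_append, List.append_nil] at h1 h2
  exact h2.symm.trans h1

end Longest

end GRS

/-- In a finite generalized root system, for every `x ∈ X` there is a unique
element `ω_0^x = (x, g, y)` of the Weyl groupoid ending at `x` of maximal length among the
elements ending at `x`; moreover the maximal lengths at any two points `x, y` coincide. -/
theorem stmt6 {θ : ℕ} {X : Type*} (R : GRS θ X) (hfin : R.FiniteWeyl) :
    (∀ x : X, ∃! p : ((Fin θ → ℤ) → (Fin θ → ℤ)) × X,
      R.Weyl x p.1 p.2 ∧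
      ∀ (g : (Fin θ → ℤ) → (Fin θ → ℤ)) (y : X), R.Weyl x g y →
        R.len x g y ≤ R.len x p.1 p.2) ∧
    (∀ x y : X,
      sSup {t : ℕ | ∃ (g : (Fin θ → ℤ) → (Fin θ → ℤ)) (z : X), R.Weyl x g z ∧ R.len x g z = t} =
      sSup {t : ℕ | ∃ (g : (Fin θ → ℤ) → (Fin θ → ℤ)) (z : X), R.Weyl y g z ∧ R.len y g z = t}) := by
  have hpos := GRS.finite_posOn_univ hfin
  have hle : ∀ x l, (R.len x (R.wordMap x l) (R.wordEnd x l) : ℕ∞) ≤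
      (R.posOn Set.univ x).encard := fun x l => by
    rw [GRS.coe_len hpos, GRS.encard_posOn_univ_eq x (R.wordEnd x l)]
    exact Set.encard_le_encard fun v hv => hv.1
  have hmax : ∀ {x l}, R.posOn Set.univ (R.wordEnd x l) ⊆ R.wordInv x l →
      (R.len x (R.wordMap x l) (R.wordEnd x l) : ℕ∞) = (R.posOn Set.univ x).encard := by
    intro x l hl
    refine (hle x l).antisymm ?_
    rw [GRS.coe_len hpos, GRS.encard_posOn_univ_eq x (R.wordEnd x l)]
    exact Set.encard_le_encard hl
  have hgreatest : ∀ x : X, IsGreatest {t : ℕ | ∃ (g : (Fin θ → ℤ) → (Fin θ → ℤ)) (z : X),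
      R.Weyl x g z ∧ R.len x g z = t} (R.posOn Set.univ x).ncard := fun x => by
    constructor
    · obtain ⟨l, hl⟩ := GRS.exists_posOn_subset_wordInv hfin x
      refine ⟨_, _, R.weyl_iff.2 ⟨l, rfl, rfl⟩, ?_⟩
      rw [Set.ncard, ← hmax hl, ENat.toNat_natCast]
    · rintro _ ⟨g, z, hw, rfl⟩
      obtain ⟨l, rfl, rfl⟩ := R.weyl_iff.1 hw
      have := hle x l
      rw [← (hpos x).cast_ncard_eq] at this
      exact_mod_cast this
  constructor
  · intro x
    obtain ⟨l, hl⟩ := GRS.exists_posOn_subset_wordInv hfin x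
    refine ⟨(R.wordMap x l, R.wordEnd x l), ⟨R.weyl_iff.2 ⟨l, rfl, rfl⟩, fun g y hw => ?_⟩, ?_⟩
    · obtain ⟨l', rfl, rfl⟩ := R.weyl_iff.1 hw
      have := hle x l'
      rw [← hmax hl] at this
      exact_mod_cast this
    · rintro ⟨g, y⟩ ⟨hw, hm⟩
      obtain ⟨l', rfl, rfl⟩ := R.weyl_iff.1 hw
      have hge := hm _ _ (R.weyl_iff.2 ⟨l, rfl, rfl⟩)
      have hge' : (R.posOn Set.univ x).encard ≤
          (R.len x (R.wordMap x l') (R.wordEnd x l') : ℕ∞) := by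
        rw [← hmax hl]
        exact_mod_cast hge
      rw [GRS.coe_len hpos, GRS.encard_posOn_univ_eq x (R.wordEnd x l')] at hge'
      have hl' := ((hpos _).eq_of_subset_of_encard_le' (fun v hv => hv.1) hge').ge
      have h := GRS.wordEq_of_posOn_subset_wordInv hfin hl' hl
      exact Prod.ext h.2 h.1
  · intro x y
    rw [(hgreatest x).csSup_eq, (hgreatest y).csSup_eq, Set.ncard, Set.ncard,
      GRS.encard_posOn_univ_eq x y]
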